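/- Assume m + p ≥ 2. Then for every σ > 2(1−p)/(m−1), the profile equation (SSODE) admits a good profile with interface of Type II whose behavior at the origin is (B3), i.e. f(0) = 0 and f(ξ)ξ^{−(σ+2)/(m−p)} converges to a positive constant as ξ → 0⁺. -/

import Mathlib

open Real Filter Set Topology

noncomputable def alphaC (m p σ : ℝ) : ℝ := (σ + 2) / (σ * (m - 1) + 2 * (p - 1))

noncomputable def betaC (m p σ : ℝ) : ℝ := (m - p) / (σ * (m - 1) + 2 * (p - 1))

/-- The self-similar profile ODE (SSODE) at the point `ξ`. -/
def SSODE (N : ℕ) (m p σ : ℝ) (f : ℝ → ℝ) (ξ : ℝ) : Prop :=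
  deriv (deriv fun x => f x ^ m) ξ + ((N : ℝ) - 1) / ξ * deriv (fun x => f x ^ m) ξ
    - alphaC m p σ * f ξ + betaC m p σ * ξ * deriv f ξ + ξ ^ σ * f ξ ^ p = 0

/-- `f` is a profile with interface at `ξ0`. -/
def ProfileWithInterface (N : ℕ) (m p σ : ℝ) (f : ℝ → ℝ) (ξ0 : ℝ) : Prop :=
  0 < ξ0 ∧
  ContinuousOn f (Icc 0 ξ0) ∧
  (∀ ξ ∈ Ioo 0 ξ0, 0 < f ξ) ∧
  ContDiffOn ℝ 2 f (Ioo 0 ξ0) ∧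
  (∀ ξ ∈ Ioo 0 ξ0, SSODE N m p σ f ξ) ∧
  f ξ0 = 0 ∧
  Tendsto (fun ξ => deriv (fun x => f x ^ m) ξ) (𝓝[<] ξ0) (𝓝 0)

/-- Interface of Type I: `f(ξ) ~ (ξ0 - ξ)^(1/(m-1))` as `ξ → ξ0⁻`. -/
def TypeI (m : ℝ) (f : ℝ → ℝ) (ξ0 : ℝ) : Prop :=
  ∃ c, 0 < c ∧ Tendsto (fun ξ => f ξ * (ξ0 - ξ) ^ (-(1 / (m - 1)))) (𝓝[<] ξ0) (𝓝 c)

/-- Interface of Type II: `f(ξ) ~ (ξ0 - ξ)^(1/(1-p))` as `ξ → ξ0⁻`. -/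
def TypeII (p : ℝ) (f : ℝ → ℝ) (ξ0 : ℝ) : Prop :=
  ∃ c, 0 < c ∧ Tendsto (fun ξ => f ξ * (ξ0 - ξ) ^ (-(1 / (1 - p)))) (𝓝[<] ξ0) (𝓝 c)

/-- Behavior (B1) at the origin. -/
def BehB1 (N : ℕ) (m p σ : ℝ) (f : ℝ → ℝ) : Prop :=
  0 < f 0 ∧ Tendsto (fun ξ => (f ξ ^ (m - 1) - f 0 ^ (m - 1)) / ξ ^ 2)
    (𝓝[>] 0) (𝓝 (alphaC m p σ * (m - 1) / (2 * m * (N : ℝ))))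

/-- Behavior (B2) at the origin. -/
def BehB2 (N : ℕ) (m : ℝ) (f : ℝ → ℝ) : Prop :=
  f 0 = 0 ∧ Tendsto (fun ξ => f ξ * ξ ^ (-(2 / (m - 1)))) (𝓝[>] 0)
    (𝓝 (((m - 1) / (2 * m * (m * (N : ℝ) - (N : ℝ) + 2))) ^ (1 / (m - 1))))

/-- Behavior (B3) at the origin. -/
def BehB3 (m p σ : ℝ) (f : ℝ → ℝ) : Prop :=
  f 0 = 0 ∧ ∃ K, 0 < K ∧
    Tendsto (fun ξ => f ξ * ξ ^ (-((σ + 2) / (m - p)))) (𝓝[>] 0) (𝓝 K)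

/-- A good profile with interface at `ξ0`. -/
def GoodProfile (N : ℕ) (m p σ : ℝ) (f : ℝ → ℝ) (ξ0 : ℝ) : Prop :=
  ProfileWithInterface N m p σ f ξ0 ∧
  (BehB1 N m p σ f ∨ BehB2 N m f ∨ BehB3 m p σ f)

noncomputable def xiMax (m p σ : ℝ) : ℝ := (betaC m p σ ^ 2 / (4 * m)) ^ (1 / (σ - 2))

/-- Truncated problem: existence and invariance of the strip. -/
lemma step_exists (H : ℝ × ℝ × ℝ → ℝ)
    (hH : ContDiffOn ℝ 1 H {x | 0 < x.1 ∧ 0 < x.2.1})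
    {v1 v2 Z0 T δ : ℝ} (hv : v1 < v2) (hv2 : v2 < 0) (hδ : 0 < δ) (hδT : δ ≤ T) (hδZ : δ ≤ Z0)
    (h1 : ∀ t z, 0 < t → t ≤ T → 0 < z → z ≤ Z0 → 0 < H (t, z, v1))
    (h2 : ∀ t z, 0 < t → t ≤ T → 0 < z → z ≤ Z0 → H (t, z, v2) < 0) :
    ∃ z v : ℝ → ℝ, z δ = Z0 ∧ ∀ t ∈ Icc δ T,
      HasDerivWithinAt z (v t) (Icc δ T) t ∧
      HasDerivWithinAt v (H (t, max δ (z t), v t)) (Icc δ T) t ∧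
      v1 ≤ v t ∧ v t ≤ v2 ∧ z t ≤ Z0 := by
  let cz : ℝ → ℝ := fun x => max δ (min Z0 x)
  let cv : ℝ → ℝ := fun x => max v1 (min v2 x)
  have hcz : LipschitzWith 1 cz := (LipschitzWith.id.const_min Z0).const_max δ
  have hcv : LipschitzWith 1 cv := (LipschitzWith.id.const_min v2).const_max v1
  have hczm : ∀ x, cz x ∈ Icc δ Z0 := fun x => ⟨le_max_left _ _, max_le hδZ (min_le_left _ _)⟩
  have hcvm : ∀ x, cv x ∈ Icc v1 v2 := fun x => ⟨le_max_left _ _, max_le hv.le (min_le_left _ _)⟩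
  let S : Set (ℝ × ℝ × ℝ) := Icc δ T ×ˢ (Icc δ Z0 ×ˢ Icc v1 v2)
  have hSc : IsCompact S := isCompact_Icc.prod (isCompact_Icc.prod isCompact_Icc)
  have hSv : Convex ℝ S := (convex_Icc _ _).prod ((convex_Icc _ _).prod (convex_Icc _ _))
  have hSsub : S ⊆ {x | 0 < x.1 ∧ 0 < x.2.1} := fun x hx =>
    ⟨lt_of_lt_of_le hδ hx.1.1, lt_of_lt_of_le hδ hx.2.1.1⟩
  have hHS := hH.mono hSsub
  obtain ⟨K, hK⟩ := hHS.exists_lipschitzOnWith one_ne_zero hSv hSc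
  obtain ⟨M, hM⟩ := hSc.exists_bound_of_continuousOn hHS.continuousOn
  let X : ℝ → ℝ × ℝ → ℝ × ℝ := fun t x => (cv x.2, H (t, cz x.1, cv x.2))
  have hXmem : ∀ t ∈ Icc δ T, ∀ x : ℝ × ℝ, (t, cz x.1, cv x.2) ∈ S := fun t ht x =>
    ⟨ht, hczm _, hcvm _⟩
  have hin : ∀ t : ℝ, LipschitzWith 1 (fun x : ℝ × ℝ => ((t, cz x.1, cv x.2) : ℝ × ℝ × ℝ)) := by
    intro t
    have a1 : LipschitzWith 1 (fun x : ℝ × ℝ => cz x.1) := by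
      simpa [Function.comp_def] using hcz.comp LipschitzWith.prod_fst
    have a2 : LipschitzWith 1 (fun x : ℝ × ℝ => cv x.2) := by
      simpa [Function.comp_def] using hcv.comp LipschitzWith.prod_snd
    have := (LipschitzWith.const' (α := ℝ × ℝ) (K := 0) t).prodMk (a1.prodMk a2)
    simpa using this
  have hXL : ∀ t ∈ Icc δ T, LipschitzWith (max 1 K) (X t) := by
    intro t ht
    have a2 : LipschitzWith 1 (fun x : ℝ × ℝ => cv x.2) := by
      simpa [Function.comp_def] using hcv.comp LipschitzWith.prod_snd
    have a3 : LipschitzWith K (fun x : ℝ × ℝ => H (t, cz x.1, cv x.2)) := by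
      have := hK.comp (hin t).lipschitzOnWith (s := univ) (fun x _ => hXmem t ht x)
      rw [lipschitzOnWith_univ] at this
      simpa [Function.comp_def] using this
    exact a2.prodMk a3
  let L : NNReal := Real.toNNReal (max (max |v1| |v2|) M)
  have hXb : ∀ t ∈ Icc δ T, ∀ x, ‖X t x‖ ≤ L := by
    intro t ht x
    have : max (max |v1| |v2|) M ≤ L := Real.le_coe_toNNReal _
    refine le_trans ?_ this
    rw [Prod.norm_def]
    refine max_le_max ?_ (hM _ (hXmem t ht x))
    rw [Real.norm_eq_abs]
    exact abs_le_max_abs_abs (hcvm _).1 (hcvm _).2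
  have hPL : IsPicardLindelof X (⟨δ, ⟨le_rfl, hδT⟩⟩ : Icc δ T) ((Z0, (v1 + v2) / 2) : ℝ × ℝ)
      (L * Real.toNNReal (T - δ)) 0 L (max 1 K) := by
    refine ⟨fun t ht => (hXL t ht).lipschitzOnWith, fun x _ => ?_, fun t ht x _ => hXb t ht x, ?_⟩
    · refine continuousOn_const.prodMk ?_
      exact hHS.continuousOn.comp (by fun_prop) (fun t ht => hXmem t ht x)
    · simp [hδT]
  obtain ⟨Y, hY0, hY⟩ := hPL.exists_eq_forall_mem_Icc_hasDerivWithinAt₀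
  have hz : ∀ t ∈ Icc δ T, HasDerivWithinAt (fun s => (Y s).1) (cv (Y t).2) (Icc δ T) t :=
    fun t ht => (hY t ht).fst
  have hvd : ∀ t ∈ Icc δ T, HasDerivWithinAt (fun s => (Y s).2) (H (t, cz (Y t).1, cv (Y t).2))
      (Icc δ T) t := fun t ht => (hY t ht).snd
  have toIci : ∀ {g : ℝ → ℝ} {g' t : ℝ}, t ∈ Ico δ T → HasDerivWithinAt g g' (Icc δ T) t →
      HasDerivWithinAt g g' (Ici t) t := by
    intro g g' t ht h
    exact h.mono_of_mem_nhdsWithin (Icc_mem_nhdsGE_of_mem ht)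
  have hvc : ContinuousOn (fun s => (Y s).2) (Icc δ T) := fun t ht => (hvd t ht).continuousWithinAt
  have hzc : ContinuousOn (fun s => (Y s).1) (Icc δ T) := fun t ht => (hz t ht).continuousWithinAt
  have hup : ∀ t ∈ Icc δ T, (Y t).2 ≤ v2 := by
    intro t ht
    refine image_le_of_deriv_right_lt_deriv_boundary (B := fun _ => v2) (B' := fun _ => 0) hvc
      (fun x hx => toIci hx (hvd x (Ico_subset_Icc_self hx))) ?_ (fun x => hasDerivAt_const x v2)
      ?_ ht
    · simp [hY0]; linarith
    · intro x hx hxv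
      have : cv (Y x).2 = v2 := by simp only [cv]; rw [hxv]; simp [hv.le]
      rw [this]
      exact h2 _ _ (lt_of_lt_of_le hδ hx.1) hx.2.le (lt_of_lt_of_le hδ (hczm _).1) (hczm _).2
  have hlo : ∀ t ∈ Icc δ T, v1 ≤ (Y t).2 := by
    intro t ht
    have := image_le_of_deriv_right_lt_deriv_boundary (f := fun s => -(Y s).2)
      (B := fun _ => -v1) (B' := fun _ => 0) hvc.neg
      (fun x hx => (toIci hx (hvd x (Ico_subset_Icc_self hx))).neg) ?_
      (fun x => hasDerivAt_const x (-v1))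
      ?_ ht
    · simpa using this
    · simp [hY0]; linarith
    · intro x hx hxv
      have hxv' : (Y x).2 = v1 := by simpa using hxv
      have : cv (Y x).2 = v1 := by simp only [cv]; rw [hxv']; simp [hv.le]
      rw [this]
      have := h1 x _ (lt_of_lt_of_le hδ hx.1) hx.2.le (lt_of_lt_of_le hδ (hczm (Y x).1).1) (hczm _).2
      linarith
  have hcvid : ∀ t ∈ Icc δ T, cv (Y t).2 = (Y t).2 := by
    intro t ht
    simp only [cv]; rw [min_eq_right (hup t ht), max_eq_right (hlo t ht)]
  have hzle : ∀ t ∈ Icc δ T, (Y t).1 ≤ Z0 := by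
    intro t ht
    refine image_le_of_deriv_right_lt_deriv_boundary (B := fun _ => Z0) (B' := fun _ => 0) hzc
      (fun x hx => toIci hx (hz x (Ico_subset_Icc_self hx))) ?_ (fun x => hasDerivAt_const x Z0)
      ?_ ht
    · simp [hY0]
    · intro x hx _
      exact lt_of_le_of_lt (hcvm _).2 hv2
  refine ⟨fun s => (Y s).1, fun s => (Y s).2, by simp [hY0], fun t ht => ⟨?_, ?_, hlo t ht, hup t ht,
    hzle t ht⟩⟩
  · have := hz t ht
    rwa [hcvid t ht] at this
  · have := hvd t ht
    rw [hcvid t ht] at this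
    have e : cz (Y t).1 = max δ (Y t).1 := by
      simp only [cz]; rw [min_eq_right (hzle t ht)]
    rwa [e] at this

lemma limit_deriv {l : Filter ℕ} [l.NeBot] {a b C : ℝ} {φ ψ : ℕ → ℝ → ℝ} {Φ Ψ : ℝ → ℝ}
    (h : ∀ᶠ n in l, ∀ s ∈ Icc a b, HasDerivWithinAt (φ n) (ψ n s) (Icc a b) s)
    (hL : ∀ᶠ n in l, ∀ s ∈ Icc a b, ∀ r ∈ Icc a b, |ψ n s - ψ n r| ≤ C * |s - r|)
    (hφ : ∀ s ∈ Icc a b, Tendsto (fun n => φ n s) l (𝓝 (Φ s)))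
    (hψ : ∀ s ∈ Icc a b, Tendsto (fun n => ψ n s) l (𝓝 (Ψ s))) :
    ∀ s ∈ Ioo a b, HasDerivAt Φ (Ψ s) s := by
  intro s hs
  have hsI := Ioo_subset_Icc_self hs
  have hC : 0 ≤ C := by
    obtain ⟨n, hn⟩ := hL.exists
    have := (abs_nonneg _).trans (hn s hsI b ⟨(hs.1.trans hs.2).le, le_rfl⟩)
    have h2 : 0 < |s - b| := abs_pos.2 (sub_ne_zero.2 hs.2.ne)
    exact nonneg_of_mul_nonneg_left this h2
  have key : ∀ r ∈ Icc a b, |Φ r - Φ s - Ψ s * (r - s)| ≤ C * |r - s| * |r - s| := by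
    intro r hr
    have hlim : Tendsto (fun n => |φ n r - φ n s - ψ n s * (r - s)|) l
        (𝓝 |Φ r - Φ s - Ψ s * (r - s)|) :=
      (((hφ r hr).sub (hφ s hsI)).sub ((hψ s hsI).mul_const _)).abs
    refine le_of_tendsto hlim ?_
    filter_upwards [h, hL] with n hn hLn
    have hsub : uIcc s r ⊆ Icc a b := uIcc_subset_Icc hsI hr
    have := (convex_uIcc s r).norm_image_sub_le_of_norm_hasDerivWithin_le
      (f := fun x => φ n x - ψ n s * x) (f' := fun x => ψ n x - ψ n s * 1) (C := C * |r - s|)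
      (fun x hx => ((hn x (hsub hx)).mono hsub).sub ((hasDerivWithinAt_id x _).const_mul _))
      (fun x hx => by
        rw [mul_one, Real.norm_eq_abs]
        refine (hLn x (hsub hx) s hsI).trans ?_
        exact mul_le_mul_of_nonneg_left (abs_sub_left_of_mem_uIcc hx) hC)
      left_mem_uIcc right_mem_uIcc
    rw [Real.norm_eq_abs, Real.norm_eq_abs] at this
    refine le_trans (le_of_eq ?_) this
    congr 1
    ring
  rw [hasDerivAt_iff_isLittleO]
  have hb : (fun x' => Φ x' - Φ s - (x' - s) • Ψ s) =O[𝓝 s] fun x' => (x' - s) ^ 2 := by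
    refine Asymptotics.IsBigO.of_bound C ?_
    filter_upwards [Icc_mem_nhds hs.1 hs.2] with r hr
    have := key r hr
    rw [Real.norm_eq_abs, Real.norm_eq_abs, abs_pow, smul_eq_mul, mul_comm (r - s)]
    nlinarith
  refine hb.trans_isLittleO ?_
  have := (Asymptotics.isLittleO_pow_id (𝕜 := ℝ) (n := 2) (by norm_num)).comp_tendsto
    (show Tendsto (fun x' => x' - s) (𝓝 s) (𝓝 0) by
      simpa using (tendsto_id (x := 𝓝 s)).sub_const s)
  exact this


lemma slope_bounds {z v : ℝ → ℝ} {a b v1 v2 : ℝ}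
    (hd : ∀ t ∈ Icc a b, HasDerivWithinAt z (v t) (Icc a b) t)
    (hv : ∀ t ∈ Icc a b, v1 ≤ v t ∧ v t ≤ v2) {r s : ℝ} (har : a ≤ r) (hrs : r ≤ s) (hsb : s ≤ b) :
    v1 * (s - r) ≤ z s - z r ∧ z s - z r ≤ v2 * (s - r) := by
  rcases hrs.eq_or_lt with rfl | hlt
  · simp
  have hc : ContinuousOn z (Icc r s) := fun t ht =>
    ((hd t ⟨har.trans ht.1, ht.2.trans hsb⟩).mono (Icc_subset_Icc har hsb)).continuousWithinAt
  obtain ⟨c, hc1, hc2⟩ := exists_hasDerivAt_eq_slope z v hlt hc (fun x hx =>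
    (hd x ⟨har.trans hx.1.le, hx.2.le.trans hsb⟩).hasDerivAt
      (Icc_mem_nhds (lt_of_le_of_lt har hx.1) (lt_of_lt_of_le hx.2 hsb)))
  have h := hv c ⟨har.trans hc1.1.le, hc1.2.le.trans hsb⟩
  have hpos : 0 < s - r := sub_pos.2 hlt
  rw [hc2, le_div_iff₀ hpos, div_le_iff₀ hpos] at h
  exact h

lemma ultralim {l : Ultrafilter ℕ} {u : ℕ → ℝ} {a b : ℝ} (h : ∀ᶠ n in (l : Filter ℕ), u n ∈ Icc a b) :
    ∃ x ∈ Icc a b, Tendsto u l (𝓝 x) := by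
  obtain ⟨x, hx, hl⟩ := (isCompact_Icc (a := a) (b := b)).ultrafilter_le_nhds (l.map u)
    (by rw [le_principal_iff]; exact h)
  exact ⟨x, hx, hl⟩

lemma flow_exists (H : ℝ × ℝ × ℝ → ℝ)
    (hH : ContDiffOn ℝ 1 H {x | 0 < x.1 ∧ 0 < x.2.1})
    {v1 v2 Z0 T : ℝ} (hv : v1 < v2) (hv2 : v2 < 0) (hT : 0 < T) (hZ : 0 < Z0)
    (hend : Z0 + v2 * T < 0)
    (h1 : ∀ t z, 0 < t → t ≤ T → 0 < z → z ≤ Z0 → 0 < H (t, z, v1))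
    (h2 : ∀ t z, 0 < t → t ≤ T → 0 < z → z ≤ Z0 → H (t, z, v2) < 0) :
    ∃ (z v : ℝ → ℝ) (t0 : ℝ), 0 < t0 ∧ t0 ≤ T ∧ z 0 = Z0 ∧ z t0 = 0 ∧
      (∀ r s, 0 ≤ r → r ≤ s → s ≤ t0 → v1 * (s - r) ≤ z s - z r ∧ z s - z r ≤ v2 * (s - r)) ∧
      ∀ t ∈ Ioo 0 t0, HasDerivAt z (v t) t ∧ HasDerivAt v (H (t, z t, v t)) t ∧
        v1 ≤ v t ∧ v t ≤ v2 := by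
  let δ : ℕ → ℝ := fun n => min T Z0 / (n + 1)
  have hmin : 0 < min T Z0 := lt_min hT hZ
  have hδ : ∀ n, 0 < δ n := fun n => by positivity
  have hδle : ∀ n, δ n ≤ min T Z0 := fun n => div_le_self hmin.le (by linarith [Nat.cast_nonneg (α := ℝ) n])
  have hδlim : Tendsto δ (hyperfilter ℕ : Filter ℕ) (𝓝 0) := by
    have : Tendsto δ atTop (𝓝 0) := by
      simpa [δ, div_eq_mul_inv] using
        (tendsto_one_div_add_atTop_nhds_zero_nat (𝕜 := ℝ)).const_mul (min T Z0)
    exact this.mono_left (Nat.hyperfilter_le_atTop)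
  have hstep := fun n => step_exists H hH hv hv2 (hδ n) ((hδle n).trans (min_le_left _ _))
    ((hδle n).trans (min_le_right _ _)) h1 h2
  choose zn vn hz0 hn using hstep
  set l : Ultrafilter ℕ := hyperfilter ℕ with hl
  have hslope : ∀ n r s, δ n ≤ r → r ≤ s → s ≤ T →
      v1 * (s - r) ≤ zn n s - zn n r ∧ zn n s - zn n r ≤ v2 * (s - r) := fun n r s a1 a2 a3 =>
    slope_bounds (fun t ht => (hn n t ht).1) (fun t ht => ⟨(hn n t ht).2.2.1, (hn n t ht).2.2.2.1⟩)
      a1 a2 a3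
  have hev : ∀ t, 0 < t → ∀ᶠ n in (l : Filter ℕ), δ n < t := fun t ht =>
    hδlim.eventually (gt_mem_nhds ht)
  have hZ' : ∀ t : ℝ, ∃ x : ℝ, (t ≤ 0 → x = Z0) ∧
      (0 < t → t ≤ T → Tendsto (fun n => zn n t) l (𝓝 x)) := by
    intro t
    by_cases ht : 0 < t ∧ t ≤ T
    · obtain ⟨x, -, hx⟩ := ultralim (l := l) (u := fun n => zn n t) (a := Z0 + v1 * T) (b := Z0) (by
        filter_upwards [hev t ht.1] with n hnt
        refine ⟨?_, (hn n t ⟨hnt.le, ht.2⟩).2.2.2.2⟩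
        have := (hslope n (δ n) t le_rfl hnt.le ht.2).1
        rw [hz0] at this
        nlinarith [hδ n, ht.2])
      exact ⟨x, fun h => absurd ht.1 (not_lt.2 h), fun _ _ => hx⟩
    · exact ⟨Z0, fun _ => rfl, fun a b => absurd ⟨a, b⟩ ht⟩
  choose z hzz hzl using hZ'
  have hV' : ∀ t : ℝ, ∃ x : ℝ, (0 < t → t ≤ T → x ∈ Icc v1 v2 ∧ Tendsto (fun n => vn n t) l (𝓝 x)) := by
    intro t
    by_cases ht : 0 < t ∧ t ≤ T
    · obtain ⟨x, hx1, hx⟩ := ultralim (l := l) (u := fun n => vn n t) (a := v1) (b := v2) (by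
        filter_upwards [hev t ht.1] with n hnt
        exact ⟨(hn n t ⟨hnt.le, ht.2⟩).2.2.1, (hn n t ⟨hnt.le, ht.2⟩).2.2.2.1⟩)
      exact ⟨x, fun _ _ => ⟨hx1, hx⟩⟩
    · exact ⟨Z0, fun a b => absurd ⟨a, b⟩ ht⟩
  choose v hvl using hV'
  have hsl : ∀ r s, 0 ≤ r → r ≤ s → s ≤ T →
      v1 * (s - r) ≤ z s - z r ∧ z s - z r ≤ v2 * (s - r) := by
    intro r s hr hrs hs
    rcases hrs.eq_or_lt with rfl | hlt
    · simp
    rcases hr.eq_or_lt with rfl | hr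
    · have hs0 := hzl s hlt hs
      rw [hzz 0 le_rfl]
      have ht1 : Tendsto (fun n => v1 * (s - δ n)) l (𝓝 (v1 * (s - 0))) :=
        (tendsto_const_nhds.sub hδlim).const_mul _
      have ht2 : Tendsto (fun n => v2 * (s - δ n)) l (𝓝 (v2 * (s - 0))) :=
        (tendsto_const_nhds.sub hδlim).const_mul _
      constructor
      · refine le_of_tendsto_of_tendsto ht1 (hs0.sub_const Z0) ?_
        filter_upwards [hev s hlt] with n hn1
        have := (hslope n (δ n) s le_rfl hn1.le hs).1
        rwa [hz0] at this
      · refine le_of_tendsto_of_tendsto (hs0.sub_const Z0) ht2 ?_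
        filter_upwards [hev s hlt] with n hn1
        have := (hslope n (δ n) s le_rfl hn1.le hs).2
        rwa [hz0] at this
    · have hlim := (hzl s (hr.trans hlt) hs).sub (hzl r hr (hrs.trans hs))
      constructor
      · refine ge_of_tendsto hlim ?_
        filter_upwards [hev r hr] with n hn1
        exact (hslope n r s hn1.le hrs hs).1
      · refine le_of_tendsto hlim ?_
        filter_upwards [hev r hr] with n hn1
        exact (hslope n r s hn1.le hrs hs).2
  have hzc : ContinuousOn z (Icc 0 T) := by
    have : LipschitzOnWith (Real.toNNReal (-v1)) z (Icc 0 T) := by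
      refine LipschitzOnWith.of_le_add_mul _ (fun x hx y hy => ?_)
      rw [Real.coe_toNNReal _ (by linarith), Real.dist_eq]
      rcases le_total x y with hxy | hxy
      · have := hsl x y hx.1 hxy hy.2
        rw [abs_sub_comm, abs_of_nonneg (sub_nonneg.2 hxy)]
        linarith
      · have := hsl y x hy.1 hxy hx.2
        rw [abs_of_nonneg (sub_nonneg.2 hxy)]
        nlinarith [sub_nonneg.2 hxy]
    exact this.continuousOn
  have hzT : z T < 0 := by
    have := (hsl 0 T le_rfl hT.le le_rfl).2
    rw [hzz 0 le_rfl] at this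
    linarith
  obtain ⟨t0, ht0, hzt0⟩ : (0 : ℝ) ∈ z '' Icc 0 T :=
    intermediate_value_Icc' hT.le hzc ⟨hzT.le, by rw [hzz 0 le_rfl]; exact hZ.le⟩
  have ht0pos : 0 < t0 := by
    rcases ht0.1.eq_or_lt with h | h
    · rw [← h, hzz 0 le_rfl] at hzt0; linarith
    · exact h
  refine ⟨z, v, t0, ht0pos, ht0.2, hzz 0 le_rfl, hzt0,
    fun r s a1 a2 a3 => hsl r s a1 a2 (a3.trans ht0.2), fun t ht => ?_⟩
  have hvt := (hvl t ht.1 (ht.2.le.trans ht0.2)).1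
  -- local box
  obtain ⟨t', htt', ht't0⟩ := exists_between ht.2
  have ht'T : t' ≤ T := ht't0.le.trans ht0.2
  have ht'0 : 0 < t' := ht.1.trans htt'
  have hzt' : 0 < z t' := by
    have := (hsl t' t0 ht'0.le ht't0.le ht0.2).2
    rw [hzt0] at this
    nlinarith
  have hzt'Z : z t' ≤ Z0 := by
    have := (hsl 0 t' le_rfl ht'0.le ht'T).2
    rw [hzz 0 le_rfl] at this
    nlinarith
  set η := z t' / 2 with hη
  have hηpos : 0 < η := by positivity
  let S : Set (ℝ × ℝ × ℝ) := Icc (t / 2) t' ×ˢ (Icc η Z0 ×ˢ Icc v1 v2)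
  have hSc : IsCompact S := isCompact_Icc.prod (isCompact_Icc.prod isCompact_Icc)
  have hSv : Convex ℝ S := (convex_Icc _ _).prod ((convex_Icc _ _).prod (convex_Icc _ _))
  have ht2 : 0 < t / 2 := half_pos ht.1
  have hSsub : S ⊆ {x | 0 < x.1 ∧ 0 < x.2.1} := fun x hx =>
    ⟨lt_of_lt_of_le ht2 hx.1.1, lt_of_lt_of_le hηpos hx.2.1.1⟩
  have hHS := hH.mono hSsub
  obtain ⟨K, hK⟩ := hHS.exists_lipschitzOnWith one_ne_zero hSv hSc
  obtain ⟨M, hM⟩ := hSc.exists_bound_of_continuousOn hHS.continuousOn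
  have hgood : ∀ᶠ n in (l : Filter ℕ), δ n < t / 2 ∧ δ n < η ∧ η < zn n t' := by
    filter_upwards [hev _ ht2, hev _ hηpos,
      (hzl t' ht'0 ht'T).eventually (lt_mem_nhds (show η < z t' by linarith))] with n a1 a2 a3
    exact ⟨a1, a2, a3⟩
  have hbox : ∀ n, (δ n < t / 2 ∧ δ n < η ∧ η < zn n t') → ∀ s ∈ Icc (t / 2) t',
      (s, zn n s, vn n s) ∈ S ∧ max (δ n) (zn n s) = zn n s ∧ s ∈ Icc (δ n) T := by
    intro n ⟨a1, a2, a3⟩ s hs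
    have hsI : s ∈ Icc (δ n) T := ⟨a1.le.trans hs.1, hs.2.trans ht'T⟩
    have hb := (hslope n s t' hsI.1 hs.2 ht'T).2
    have hnn := hn n s hsI
    have hzs : η ≤ zn n s := by nlinarith [hs.2]
    exact ⟨⟨hs, ⟨hzs, hnn.2.2.2.2⟩, hnn.2.2.1, hnn.2.2.2.1⟩, max_eq_right (a2.le.trans hzs), hsI⟩
  have hsubI : ∀ n, (δ n < t / 2 ∧ δ n < η ∧ η < zn n t') → Icc (t / 2) t' ⊆ Icc (δ n) T :=
    fun n h s hs => (hbox n h s hs).2.2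
  have hvd : ∀ n, (δ n < t / 2 ∧ δ n < η ∧ η < zn n t') → ∀ s ∈ Icc (t / 2) t',
      HasDerivWithinAt (vn n) (H (s, zn n s, vn n s)) (Icc (t / 2) t') s := by
    intro n h s hs
    have := (hn n s (hsubI n h hs)).2.1.mono (hsubI n h)
    rwa [(hbox n h s hs).2.1] at this
  have hvLip : ∀ n, (δ n < t / 2 ∧ δ n < η ∧ η < zn n t') → ∀ s ∈ Icc (t / 2) t',
      ∀ r ∈ Icc (t / 2) t', |vn n s - vn n r| ≤ M * |s - r| := by
    intro n h s hs r hr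
    have := (convex_Icc (t / 2) t').norm_image_sub_le_of_norm_hasDerivWithin_le
      (fun x hx => hvd n h x hx) (fun x hx => hM _ (hbox n h x hx).1) hr hs
    simpa only [Real.norm_eq_abs] using this
  have hzLip : ∀ n, (δ n < t / 2 ∧ δ n < η ∧ η < zn n t') → ∀ s ∈ Icc (t / 2) t',
      ∀ r ∈ Icc (t / 2) t', |zn n s - zn n r| ≤ -v1 * |s - r| := by
    intro n h s hs r hr
    have := (convex_Icc (t / 2) t').norm_image_sub_le_of_norm_hasDerivWithin_le
      (f := zn n) (f' := vn n) (C := -v1)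
      (fun x hx => (hn n x (hsubI n h hx)).1.mono (hsubI n h)) (fun x hx => by
        have := hn n x (hsubI n h hx)
        rw [Real.norm_eq_abs, abs_le]
        constructor <;> linarith [this.2.2.1, this.2.2.2.1]) hr hs
    simpa only [Real.norm_eq_abs] using this
  have hts : t ∈ Ioo (t / 2) t' := ⟨by linarith [ht.1], htt'⟩
  have hzlim : ∀ s ∈ Icc (t / 2) t', Tendsto (fun n => zn n s) l (𝓝 (z s)) := fun s hs =>
    hzl s (lt_of_lt_of_le ht2 hs.1) (hs.2.trans ht'T)
  have hvlim : ∀ s ∈ Icc (t / 2) t', Tendsto (fun n => vn n s) l (𝓝 (v s)) := fun s hs =>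
    (hvl s (lt_of_lt_of_le ht2 hs.1) (hs.2.trans ht'T)).2
  refine ⟨?_, ?_, hvt.1, hvt.2⟩
  · refine limit_deriv (l := l) (φ := zn) (ψ := vn) (Φ := z) (Ψ := v) (C := M) (a := t / 2) (b := t')
      ?_ ?_ hzlim hvlim t hts
    · filter_upwards [hgood] with n h s hs
      exact (hn n s (hsubI n h hs)).1.mono (hsubI n h)
    · filter_upwards [hgood] with n h
      exact hvLip n h
  · refine limit_deriv (l := l) (φ := vn) (ψ := fun n s => H (s, zn n s, vn n s)) (Φ := v)
      (Ψ := fun s => H (s, z s, v s)) (C := K * max 1 (max (-v1) M)) (a := t / 2) (b := t')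
      ?_ ?_ hvlim ?_ t hts
    · filter_upwards [hgood] with n h
      exact hvd n h
    · filter_upwards [hgood] with n h s hs r hr
      have := hK.dist_le_mul _ (hbox n h s hs).1 _ (hbox n h r hr).1
      rw [Real.dist_eq] at this
      refine this.trans ?_
      rw [mul_assoc]
      refine mul_le_mul_of_nonneg_left ?_ K.2
      rw [Prod.dist_eq, Prod.dist_eq, Real.dist_eq, Real.dist_eq, Real.dist_eq]
      have hA := abs_nonneg (s - r)
      refine max_le ?_ (max_le ?_ ?_)
      · exact le_mul_of_one_le_left hA (le_max_left _ _)
      · exact (hzLip n h s hs r hr).trans (mul_le_mul_of_nonneg_right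
          ((le_max_left _ _).trans (le_max_right _ _)) hA)
      · exact (hvLip n h s hs r hr).trans (mul_le_mul_of_nonneg_right
          ((le_max_right _ _).trans (le_max_right _ _)) hA)
    · intro s hs
      have hzs : 0 < z s := by
        have := (hsl s t' (ht2.le.trans hs.1) hs.2 ht'T).2
        nlinarith [hs.2]
      have hopen : IsOpen {x : ℝ × ℝ × ℝ | 0 < x.1 ∧ 0 < x.2.1} :=
        (isOpen_lt continuous_const continuous_fst).inter
          (isOpen_lt continuous_const (continuous_fst.comp continuous_snd))
      have hca : ContinuousAt H (s, z s, v s) :=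
        hH.continuousOn.continuousAt (hopen.mem_nhds ⟨lt_of_lt_of_le ht2 hs.1, hzs⟩)
      exact hca.tendsto.comp (tendsto_const_nhds.prodMk_nhds
        ((hzlim s hs).prodMk_nhds (hvlim s hs)))


lemma eventually_le_of_decay {v v' : ℝ → ℝ} {t1 t0 w c M : ℝ} (ht : t1 < t0)
    (hd : ∀ t ∈ Ioo t1 t0, HasDerivAt v (v' t) t) (hM : ∀ t ∈ Ioo t1 t0, M ≤ v t) (hc : 0 < c)
    (hdec : ∀ t ∈ Ioo t1 t0, w ≤ v t → v' t ≤ -(c / (t0 - t))) :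
    ∀ᶠ t in 𝓝[<] t0, v t ≤ w := by
  have hex : ∃ t2 ∈ Ioo t1 t0, v t2 ≤ w := by
    by_contra hcon
    push Not at hcon
    let φ : ℝ → ℝ := fun t => v t - c * Real.log (t0 - t)
    have hφ : ∀ t ∈ Ioo t1 t0, HasDerivAt φ (v' t - c * ((-1) / (t0 - t))) t := by
      intro t htt
      have h1 : HasDerivAt (fun t => t0 - t) (-1) t := by
        simpa using (hasDerivAt_id t).const_sub t0
      exact (hd t htt).sub ((h1.log (sub_pos.2 htt.2).ne').const_mul c)
    have hanti : AntitoneOn φ (Ioo t1 t0) := by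
      refine antitoneOn_of_deriv_nonpos (convex_Ioo _ _)
        (fun t htt => (hφ t htt).continuousAt.continuousWithinAt) ?_ ?_
      · rw [interior_Ioo]
        exact fun t htt => (hφ t htt).differentiableAt.differentiableWithinAt
      · rw [interior_Ioo]
        intro t htt
        rw [(hφ t htt).deriv]
        have := hdec t htt (hcon t htt).le
        have e : c * ((-1) / (t0 - t)) = -(c / (t0 - t)) := by ring
        rw [e]; linarith
    obtain ⟨t3, ht3⟩ := exists_between ht
    have hlog : Tendsto (fun t => φ t3 + c * Real.log (t0 - t)) (𝓝[<] t0) atBot := by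
      refine tendsto_atBot_add_const_left _ _ (Tendsto.const_mul_atBot hc ?_)
      refine Real.tendsto_log_nhdsGT_zero.comp ?_
      refine tendsto_nhdsWithin_iff.2 ⟨?_, ?_⟩
      · have : Tendsto (fun t => t0 - t) (𝓝 t0) (𝓝 (t0 - t0)) := tendsto_const_nhds.sub tendsto_id
        rw [sub_self] at this
        exact this.mono_left nhdsWithin_le_nhds
      · filter_upwards [self_mem_nhdsWithin] with t htt
        exact sub_pos.2 (mem_Iio.1 htt)
    obtain ⟨t, hlt, htt⟩ := ((hlog.eventually (eventually_lt_atBot M)).and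
      (Ioo_mem_nhdsLT ht3.2)).exists
    have h1 := hanti ht3 ⟨ht3.1.trans htt.1, htt.2⟩ htt.1.le
    have h2 := hM t ⟨ht3.1.trans htt.1, htt.2⟩
    simp only [φ] at h1 hlt
    linarith
  obtain ⟨t2, ht2, hv2⟩ := hex
  filter_upwards [Ioo_mem_nhdsLT ht2.2] with t htt
  have hsub : ∀ x ∈ Icc t2 t, x ∈ Ioo t1 t0 := fun x hx =>
    ⟨lt_of_lt_of_le ht2.1 hx.1, lt_of_le_of_lt hx.2 htt.2⟩
  refine image_le_of_deriv_right_lt_deriv_boundary (a := t2) (b := t) (f := v) (f' := v')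
    (B := fun _ => w) (B' := fun _ => 0)
    (fun x hx => (hd x (hsub x hx)).continuousAt.continuousWithinAt)
    (fun x hx => (hd x (hsub x (Ico_subset_Icc_self hx))).hasDerivWithinAt) hv2
    (fun x => hasDerivAt_const x w) ?_ ⟨htt.1.le, le_rfl⟩
  intro x hx hxv
  have hx' := hsub x (Ico_subset_Icc_self hx)
  have := hdec x hx' hxv.ge
  have hp : 0 < c / (t0 - x) := div_pos hc (sub_pos.2 hx'.2)
  linarith

lemma tendsto_of_decay {v G D : ℝ → ℝ} {t1 t0 ws κ C M : ℝ} (ht : t1 < t0)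
    (hd : ∀ t ∈ Ioo t1 t0, HasDerivAt v (-(G t) / D t) t) (hM : ∀ t ∈ Ioo t1 t0, |v t| ≤ M)
    (hκ : 0 < κ) (hC : 0 < C) (hD : ∀ t ∈ Ioo t1 t0, 0 < D t ∧ D t ≤ C * (t0 - t))
    (hup : ∀ η > 0, ∀ᶠ t in 𝓝[<] t0, ws + η ≤ v t → η * κ ≤ G t)
    (hlo : ∀ η > 0, ∀ᶠ t in 𝓝[<] t0, v t ≤ ws - η → G t ≤ -(η * κ)) :
    Tendsto v (𝓝[<] t0) (𝓝 ws) := by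
  have aux : ∀ η > 0, ∀ t ∈ Ioo t1 t0, ∀ g, η * κ ≤ g → (η * κ / C) / (t0 - t) ≤ g / D t := by
    intro η hη t htt g hg
    have h1 := hD t htt
    have h2 : 0 < η * κ := mul_pos hη hκ
    rw [div_div]
    exact div_le_div₀ (h2.le.trans hg) hg h1.1 h1.2
  have hU : ∀ η > 0, ∀ᶠ t in 𝓝[<] t0, v t ≤ ws + η := by
    intro η hη
    obtain ⟨t2, ht2, hsub⟩ := (mem_nhdsLT_iff_exists_Ioo_subset' ht).1
      (inter_mem (hup η hη) (Ioo_mem_nhdsLT ht))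
    refine eventually_le_of_decay (v' := fun t => -(G t) / D t) (c := η * κ / C) (M := -M) ht2
      (fun t htt => hd t (hsub htt).2)
      (fun t htt => (abs_le.1 (hM t (hsub htt).2)).1) (by positivity) ?_
    intro t htt hw
    have := aux η hη t (hsub htt).2 (G t) ((hsub htt).1 hw)
    rw [neg_div]; linarith
  have hL : ∀ η > 0, ∀ᶠ t in 𝓝[<] t0, ws - η ≤ v t := by
    intro η hη
    obtain ⟨t2, ht2, hsub⟩ := (mem_nhdsLT_iff_exists_Ioo_subset' ht).1
      (inter_mem (hlo η hη) (Ioo_mem_nhdsLT ht))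
    have := eventually_le_of_decay (v := fun t => - v t) (v' := fun t => -(-(G t) / D t))
      (c := η * κ / C) (M := -M) (w := -(ws - η)) ht2
      (fun t htt => (hd t (hsub htt).2).neg)
      (fun t htt => by linarith [(abs_le.1 (hM t (hsub htt).2)).2]) (by positivity) (by
        intro t htt hw
        have := aux η hη t (hsub htt).2 (-(G t)) (by
          have := (hsub htt).1 (by linarith [hw])
          linarith)
        linarith)
    filter_upwards [this] with t htt
    linarith
  rw [Metric.tendsto_nhds]
  intro ε hε
  filter_upwards [hU (ε / 2) (half_pos hε), hL (ε / 2) (half_pos hε)] with t h1 h2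
  rw [Real.dist_eq, abs_lt]
  constructor <;> linarith

set_option maxHeartbeats 2000000 in
lemma core {q k a b c B : ℝ} (hq : 0 < q) (hk : 1 ≤ k) (ha : 0 ≤ a) (hb : 0 ≤ b) (hc : 0 < c)
    (hB : 0 ≤ B) :
    ∃ (z v : ℝ → ℝ) (t0 ws : ℝ), 0 < t0 ∧ ws < 0 ∧ 0 < z 0 ∧ z t0 = 0 ∧
      ContinuousOn z (Icc 0 t0) ∧ Tendsto v (𝓝[<] t0) (𝓝 ws) ∧
      ∀ t ∈ Ioo 0 t0, 0 < z t ∧ HasDerivAt z (v t) t ∧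
        HasDerivAt v (-(1 + q * v t + B * z t ^ (k + 1) + a * t * z t ^ k * v t
          + b * t ^ 2 * z t ^ (k - 1) * v t ^ 2) / (c * t ^ 2 * z t ^ k)) t := by
  set D := B + 4 * a + 320 * b + 1 with hDdef
  have hDpos : 0 < D := by positivity
  have hk1 : 0 < k + 1 := by linarith
  obtain ⟨Z0, hZ0, hω⟩ : ∃ Z0 : ℝ, 0 < Z0 ∧ Z0 ^ (k + 1) = 1 / (2 * D) := by
    refine ⟨(1 / (2 * D)) ^ (1 / (k + 1)), by positivity, ?_⟩
    rw [← Real.rpow_mul (by positivity)]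
    rw [one_div_mul_cancel hk1.ne', Real.rpow_one]
  have hωD : D * Z0 ^ (k + 1) = 1 / 2 := by rw [hω]; field_simp
  set ω := Z0 ^ (k + 1) with hωdef
  have hωpos : 0 < ω := by rw [hω]; positivity
  have hZk : Z0 ^ k * Z0 = ω := by rw [hωdef, Real.rpow_add_one hZ0.ne']
  have hZk1 : Z0 ^ (k - 1) * Z0 ^ 2 = ω := by
    rw [hωdef, ← Real.rpow_natCast, ← Real.rpow_add hZ0]; congr 1; push_cast; ring
  set T := 4 * q * Z0 with hTdef
  have hT : 0 < T := by positivity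
  have hBω : B * ω ≤ 1 / 2 := by rw [← hωD]; gcongr; rw [hDdef]; linarith
  have haω : 4 * a * ω ≤ 1 / 2 := by rw [← hωD]; gcongr; rw [hDdef]; linarith
  have hBbω : (B + 64 * b) * ω ≤ 1 / 2 := by rw [← hωD]; gcongr; rw [hDdef]; linarith
  have hbω : 320 * b * ω ≤ 1 / 2 := by rw [← hωD]; gcongr; rw [hDdef]; linarith
  have b0 : ∀ z : ℝ, 0 < z → z ≤ Z0 → z ^ (k + 1) ≤ ω := fun z h1 h2 => by
    rw [hωdef]; exact Real.rpow_le_rpow h1.le h2 hk1.le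
  have b1 : ∀ t z : ℝ, 0 < t → t ≤ T → 0 < z → z ≤ Z0 → t * z ^ k ≤ 4 * q * ω := by
    intro t z h1 h2 h3 h4
    have : z ^ k ≤ Z0 ^ k := Real.rpow_le_rpow h3.le h4 (by linarith)
    calc t * z ^ k ≤ T * Z0 ^ k := by gcongr
      _ = 4 * q * ω := by rw [← hZk, hTdef]; ring
  have b2 : ∀ t z : ℝ, 0 < t → t ≤ T → 0 < z → z ≤ Z0 →
      t ^ 2 * z ^ (k - 1) ≤ 16 * q ^ 2 * ω := by
    intro t z h1 h2 h3 h4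
    have : z ^ (k - 1) ≤ Z0 ^ (k - 1) := Real.rpow_le_rpow h3.le h4 (by linarith)
    calc t ^ 2 * z ^ (k - 1) ≤ T ^ 2 * Z0 ^ (k - 1) := by gcongr
      _ = 16 * q ^ 2 * ω := by rw [← hZk1, hTdef]; ring
  let H : ℝ × ℝ × ℝ → ℝ := fun x => -(1 + q * x.2.2 + B * x.2.1 ^ (k + 1)
    + a * x.1 * x.2.1 ^ k * x.2.2 + b * x.1 ^ 2 * x.2.1 ^ (k - 1) * x.2.2 ^ 2)
      / (c * x.1 ^ 2 * x.2.1 ^ k)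
  have hH : ContDiffOn ℝ 1 H {x | 0 < x.1 ∧ 0 < x.2.1} := by
    have hx1 : ContDiffOn ℝ 1 (fun x : ℝ × ℝ × ℝ => x.1) {x | 0 < x.1 ∧ 0 < x.2.1} :=
      contDiff_fst.contDiffOn
    have hx2 : ContDiffOn ℝ 1 (fun x : ℝ × ℝ × ℝ => x.2.1) {x | 0 < x.1 ∧ 0 < x.2.1} :=
      (contDiff_fst.comp contDiff_snd).contDiffOn
    have hx3 : ContDiffOn ℝ 1 (fun x : ℝ × ℝ × ℝ => x.2.2) {x | 0 < x.1 ∧ 0 < x.2.1} :=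
      (contDiff_snd.comp contDiff_snd).contDiffOn
    have hr : ∀ e : ℝ, ContDiffOn ℝ 1 (fun x : ℝ × ℝ × ℝ => x.2.1 ^ e)
        {x | 0 < x.1 ∧ 0 < x.2.1} := fun e =>
      hx2.rpow_const_of_ne (fun x hx => hx.2.ne')
    refine ContDiffOn.div ?_ ?_ ?_
    · exact (((((contDiffOn_const.add (contDiffOn_const.mul hx3)).add
        (contDiffOn_const.mul (hr _))).add (((contDiffOn_const.mul hx1).mul (hr _)).mul hx3)).add
        (((contDiffOn_const.mul (hx1.pow 2)).mul (hr _)).mul (hx3.pow 2)))).neg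
    · exact (contDiffOn_const.mul (hx1.pow 2)).mul (hr _)
    · intro x hx
      have := Real.rpow_pos_of_pos hx.2 k
      have := hx.1
      positivity
  set v1 := -(2 / q) with hv1
  set v2 := -(1 / (2 * q)) with hv2def
  have hv12 : v1 < v2 := by
    rw [hv1, hv2def, neg_lt_neg_iff, div_lt_div_iff₀ (by positivity) hq]; nlinarith
  have hv2 : v2 < 0 := by rw [hv2def]; simp; positivity
  have hqv1 : q * v1 = -2 := by rw [hv1]; field_simp
  have hqv2 : q * v2 = -(1 / 2) := by rw [hv2def]; field_simp
  have hend : Z0 + v2 * T < 0 := by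
    have : v2 * T = -2 * Z0 := by rw [hTdef]; linear_combination 4 * Z0 * hqv2
    rw [this]; linarith
  have h1 : ∀ t z, 0 < t → t ≤ T → 0 < z → z ≤ Z0 → 0 < H (t, z, v1) := by
    intro t z ht htT hz hzZ
    have e0 := b0 z hz hzZ
    have e2 := b2 t z ht htT hz hzZ
    have hzk := Real.rpow_pos_of_pos hz k
    have e1 : a * t * z ^ k * v1 ≤ 0 :=
      mul_nonpos_of_nonneg_of_nonpos (by positivity) (hv12.trans hv2).le
    have e3 : b * t ^ 2 * z ^ (k - 1) * v1 ^ 2 ≤ b * 64 * ω := by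
      calc b * t ^ 2 * z ^ (k - 1) * v1 ^ 2 = b * (t ^ 2 * z ^ (k - 1)) * v1 ^ 2 := by ring
        _ ≤ b * (16 * q ^ 2 * ω) * v1 ^ 2 := by gcongr
        _ = b * 16 * ω * (q * v1) ^ 2 := by ring
        _ = b * 64 * ω := by rw [hqv1]; ring
    have e4 : B * z ^ (k + 1) ≤ B * ω := by gcongr
    have e5 : B * ω + b * 64 * ω ≤ 1 / 2 := by
      have : B * ω + b * 64 * ω = (B + 64 * b) * ω := by ring
      rw [this]; exact hBbω
    simp only [H]
    refine div_pos ?_ (by positivity)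
    rw [hqv1]
    linarith
  have h2 : ∀ t z, 0 < t → t ≤ T → 0 < z → z ≤ Z0 → H (t, z, v2) < 0 := by
    intro t z ht htT hz hzZ
    have e1 := b1 t z ht htT hz hzZ
    have hzk := Real.rpow_pos_of_pos hz k
    have hzk0 := Real.rpow_pos_of_pos hz (k + 1)
    have hzk1 := Real.rpow_pos_of_pos hz (k - 1)
    have e2 : 0 ≤ b * t ^ 2 * z ^ (k - 1) * v2 ^ 2 := by positivity
    have e3 : 0 ≤ B * z ^ (k + 1) := by positivity
    have e4 : -(1 / 4) ≤ a * t * z ^ k * v2 := by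
      have : a * (t * z ^ k) * (-v2) ≤ a * (4 * q * ω) * (-v2) := by
        have : 0 ≤ -v2 := by linarith
        gcongr
      have e : a * (4 * q * ω) * (-v2) = 2 * a * ω := by linear_combination (-4 * a * ω) * hqv2
      rw [e] at this
      linarith
    simp only [H]
    refine div_neg_of_neg_of_pos ?_ (by positivity)
    rw [hqv2]
    linarith
  obtain ⟨z, v, t0, ht0, ht0T, hz0, hzt0, hsl, hder⟩ :=
    flow_exists H hH hv12 hv2 hT hZ0 hend h1 h2
  have hzpos : ∀ t ∈ Ioo 0 t0, 0 < z t := by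
    intro t ht
    have := (hsl t t0 ht.1.le ht.2.le le_rfl).2
    rw [hzt0] at this
    have h3 : v2 * (t0 - t) < 0 := mul_neg_of_neg_of_pos hv2 (sub_pos.2 ht.2)
    linarith
  have hzle : ∀ t ∈ Ioo 0 t0, z t ≤ Z0 := by
    intro t ht
    have := (hsl 0 t le_rfl ht.1.le ht.2.le).2
    rw [hz0] at this
    have h3 : v2 * (t - 0) < 0 := mul_neg_of_neg_of_pos hv2 (sub_pos.2 ht.1)
    linarith
  have hzub : ∀ t ∈ Ioo 0 t0, z t ≤ 2 / q * (t0 - t) := by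
    intro t ht
    have := (hsl t t0 ht.1.le ht.2.le le_rfl).1
    rw [hzt0, hv1] at this
    linarith
  have hzc : ContinuousOn z (Icc 0 t0) := by
    have : LipschitzOnWith (Real.toNNReal (-v1)) z (Icc 0 t0) := by
      refine LipschitzOnWith.of_le_add_mul _ (fun x hx y hy => ?_)
      rw [Real.coe_toNNReal _ (by linarith), Real.dist_eq]
      rcases le_total x y with hxy | hxy
      · have := hsl x y hx.1 hxy hy.2
        rw [abs_sub_comm, abs_of_nonneg (sub_nonneg.2 hxy)]
        linarith
      · have := hsl y x hy.1 hxy hx.2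
        rw [abs_of_nonneg (sub_nonneg.2 hxy)]
        have h3 : v2 * (x - y) ≤ 0 := mul_nonpos_of_nonpos_of_nonneg hv2.le (sub_nonneg.2 hxy)
        have h4 : v1 * (x - y) ≤ 0 :=
          mul_nonpos_of_nonpos_of_nonneg (hv12.trans hv2).le (sub_nonneg.2 hxy)
        linarith
    exact this.continuousOn
  have hzlim : Tendsto z (𝓝[<] t0) (𝓝 0) := by
    have := hzc t0 ⟨ht0.le, le_rfl⟩
    rw [ContinuousWithinAt, hzt0] at this
    refine this.mono_left ?_
    rw [nhdsWithin_le_iff]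
    exact mem_of_superset (Ioo_mem_nhdsLT ht0) Ioo_subset_Icc_self
  have htlim : Tendsto (fun t : ℝ => t) (𝓝[<] t0) (𝓝 t0) := nhdsWithin_le_nhds
  have hrlim : ∀ e : ℝ, 0 ≤ e → Tendsto (fun t => z t ^ e) (𝓝[<] t0) (𝓝 ((0 : ℝ) ^ e)) := fun e he =>
    (Real.continuousAt_rpow_const 0 e (Or.inr he)).tendsto.comp hzlim
  set E := b * t0 ^ 2 * (0 : ℝ) ^ (k - 1) with hE
  have l0 : Tendsto (fun t => B * z t ^ (k + 1)) (𝓝[<] t0) (𝓝 0) := by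
    simpa [Real.zero_rpow hk1.ne'] using (hrlim (k + 1) hk1.le).const_mul B
  have l1 : Tendsto (fun t => a * t * z t ^ k) (𝓝[<] t0) (𝓝 0) := by
    simpa [Real.zero_rpow (show k ≠ 0 by linarith)] using
      (htlim.const_mul a).mul (hrlim k (by linarith))
  have l2 : Tendsto (fun t => b * t ^ 2 * z t ^ (k - 1)) (𝓝[<] t0) (𝓝 E) :=
    ((htlim.pow 2).const_mul b).mul (hrlim (k - 1) (by linarith))
  have hE0 : 0 ≤ E := by
    rw [hE]; have := Real.zero_rpow_nonneg (k - 1); positivity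
  have hEub : E ≤ q ^ 2 / 40 := by
    refine le_of_tendsto l2 ?_
    filter_upwards [Ioo_mem_nhdsLT ht0] with t ht
    have := b2 t (z t) ht.1 (ht.2.le.trans ht0T) (hzpos t ht) (hzle t ht)
    calc b * t ^ 2 * z t ^ (k - 1) = b * (t ^ 2 * z t ^ (k - 1)) := by ring
      _ ≤ b * (16 * q ^ 2 * ω) := by gcongr
      _ = (b * ω) * (16 * q ^ 2) := by ring
      _ ≤ (1 / 640) * (16 * q ^ 2) := by
        gcongr
        linarith
      _ = q ^ 2 / 40 := by ring
  -- the limiting slope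
  obtain ⟨ws, hws, hQ⟩ : ∃ ws ∈ Icc v1 v2, 1 + q * ws + E * ws ^ 2 = 0 := by
    have hcQ : ContinuousOn (fun w : ℝ => 1 + q * w + E * w ^ 2) (Icc v1 v2) := by fun_prop
    have := intermediate_value_Icc hv12.le hcQ (show (0 : ℝ) ∈ Icc _ _ from ⟨?_, ?_⟩)
    · exact this
    · have : E * v1 ^ 2 ≤ q ^ 2 / 40 * v1 ^ 2 := by gcongr
      have e : q ^ 2 / 40 * v1 ^ 2 = 1 / 10 := by
        have : (q * v1) ^ 2 = 4 := by rw [hqv1]; norm_num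
        linear_combination this / 40
      rw [hqv1]; linarith
    · have : 0 ≤ E * v2 ^ 2 := by positivity
      rw [hqv2]; linarith
  have hcoef : ∀ w ∈ Icc v1 v2, q / 2 ≤ q + E * (w + ws) := by
    intro w hw
    have h1 : v1 * 2 ≤ w + ws := by linarith [hw.1, hws.1]
    have h2 : E * (v1 * 2) ≤ E * (w + ws) := mul_le_mul_of_nonneg_left h1 hE0
    have h3 : q ^ 2 / 40 * (v1 * 2) ≤ E * (v1 * 2) :=
      mul_le_mul_of_nonpos_right hEub (by linarith)
    have h4 : q ^ 2 / 40 * (v1 * 2) = -q / 10 := by linear_combination (q / 20) * hqv1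
    linarith
  let G : ℝ → ℝ := fun t => 1 + q * v t + B * z t ^ (k + 1) + a * t * z t ^ k * v t
          + b * t ^ 2 * z t ^ (k - 1) * v t ^ 2
  have hvabs : ∀ t ∈ Ioo 0 t0, |v t| ≤ -v1 := by
    intro t ht
    have := hder t ht
    rw [abs_le]; constructor <;> linarith [this.2.2.1, this.2.2.2]
  have hGQ : ∀ ε > 0, ∀ᶠ t in 𝓝[<] t0, |G t - (v t - ws) * (q + E * (v t + ws))| ≤ ε := by
    intro ε hε
    have hlim : Tendsto (fun t => |B * z t ^ (k + 1)| + |a * t * z t ^ k| * (-v1)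
        + |b * t ^ 2 * z t ^ (k - 1) - E| * (-v1) ^ 2) (𝓝[<] t0) (𝓝 0) := by
      have := (l0.abs.add (l1.abs.mul_const (-v1))).add (((l2.sub_const E).abs).mul_const ((-v1) ^ 2))
      simpa using this
    filter_upwards [hlim.eventually (gt_mem_nhds hε), Ioo_mem_nhdsLT ht0] with t h1 ht
    have hva := hvabs t ht
    have e : G t - (v t - ws) * (q + E * (v t + ws)) = B * z t ^ (k + 1) + a * t * z t ^ k * v t
        + (b * t ^ 2 * z t ^ (k - 1) - E) * v t ^ 2 := by
      simp only [G]
      linear_combination hQ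
    rw [e]
    refine le_trans (abs_add_three _ _ _) (le_trans ?_ h1.le)
    rw [abs_mul (a * t * z t ^ k), abs_mul (b * t ^ 2 * z t ^ (k - 1) - E), abs_pow]
    gcongr
  have hconv : Tendsto v (𝓝[<] t0) (𝓝 ws) := by
    have hev : ∀ᶠ t in 𝓝[<] t0, z t ≤ 1 := hzlim.eventually (ge_mem_nhds one_pos)
    obtain ⟨t1, ht1, hsub⟩ := (mem_nhdsLT_iff_exists_Ioo_subset' ht0).1
      (inter_mem hev (Ioo_mem_nhdsLT ht0))
    refine tendsto_of_decay (G := G) (D := fun t => c * t ^ 2 * z t ^ k) (κ := q / 4)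
      (C := c * T ^ 2 * (2 / q)) (M := -v1) ht1 (fun t ht => (hder t (hsub ht).2).2.1)
      (fun t ht => hvabs t (hsub ht).2) (by positivity) (by positivity) ?_ ?_ ?_
    · intro t ht
      have ht' := (hsub ht).2
      have hzp := hzpos t ht'
      have hz1 : z t ≤ 1 := (hsub ht).1
      have := Real.rpow_pos_of_pos hzp k
      have htp := ht'.1
      refine ⟨by positivity, ?_⟩
      have hzk : z t ^ k ≤ 2 / q * (t0 - t) := by
        refine le_trans ?_ (hzub t ht')
        simpa using Real.rpow_le_rpow_of_exponent_ge hzp hz1 hk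
      have htT : t ≤ T := ht'.2.le.trans ht0T
      calc c * t ^ 2 * z t ^ k ≤ c * T ^ 2 * (2 / q * (t0 - t)) := by gcongr
        _ = _ := by ring
    · intro η hη
      filter_upwards [hGQ (η * (q / 4)) (by positivity), Ioo_mem_nhdsLT ht0] with t h1 ht hw
      have h2 := hcoef (v t) ⟨(hder t ht).2.2.1, (hder t ht).2.2.2⟩
      have h3 : η * (q / 2) ≤ (v t - ws) * (q + E * (v t + ws)) :=
        mul_le_mul (by linarith) h2 (by positivity) (by linarith)
      have := (abs_le.1 h1).1
      linarith
    · intro η hη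
      filter_upwards [hGQ (η * (q / 4)) (by positivity), Ioo_mem_nhdsLT ht0] with t h1 ht hw
      have h2 := hcoef (v t) ⟨(hder t ht).2.2.1, (hder t ht).2.2.2⟩
      have h3 : η * (q / 2) ≤ (ws - v t) * (q + E * (v t + ws)) :=
        mul_le_mul (by linarith) h2 (by positivity) (by linarith)
      have := (abs_le.1 h1).2
      linarith
  exact ⟨z, v, t0, ws, ht0, lt_of_le_of_lt hws.2 hv2, by rw [hz0]; exact hZ0, hzt0, hzc, hconv,
    fun t ht => ⟨hzpos t ht, (hder t ht).1, (hder t ht).2.1⟩⟩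


lemma hasDerivAt_rpow_div {e x : ℝ} (hx : 0 < x) : HasDerivAt (fun y : ℝ => y ^ e) (e * x ^ e / x) x := by
  have := Real.hasDerivAt_rpow_const (x := x) (p := e) (Or.inl hx.ne')
  rwa [Real.rpow_sub_one hx.ne', ← mul_div_assoc] at this

/-- The profile as a function of `ξ`. -/
noncomputable def prof (z : ℝ → ℝ) (s γ q : ℝ) (x : ℝ) : ℝ := x ^ γ * z (x ^ s) ^ q

/-- First derivative of the `m`-th power of the profile. -/
noncomputable def profP (z v : ℝ → ℝ) (s γ q m : ℝ) (x : ℝ) : ℝ :=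
  x ^ (m * γ - 1) * (m * γ * z (x ^ s) ^ (m * q) + m * q * s * (x ^ s * z (x ^ s) ^ (m * q - 1) * v (x ^ s)))

lemma prof_derivs {z v w : ℝ → ℝ} {t0 s γ q m ξ0 : ℝ} (hs : 0 < s) (hξ0 : ξ0 ^ s = t0)
    (hz : ∀ t ∈ Ioo 0 t0, 0 < z t ∧ HasDerivAt z (v t) t ∧ HasDerivAt v (w t) t) :
    ∀ x ∈ Ioo 0 ξ0, x ^ s ∈ Ioo 0 t0 ∧ 0 < prof z s γ q x ∧
      HasDerivAt (prof z s γ q) (x ^ γ / x * (γ * z (x ^ s) ^ q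
        + q * s * (x ^ s * z (x ^ s) ^ (q - 1) * v (x ^ s)))) x ∧
      HasDerivAt (fun y => prof z s γ q y ^ m) (profP z v s γ q m x) x ∧
      HasDerivAt (profP z v s γ q m) (x ^ (m * γ - 1) / x * (
        (m * γ - 1) * (m * γ * z (x ^ s) ^ (m * q)
          + m * q * s * (x ^ s * z (x ^ s) ^ (m * q - 1) * v (x ^ s)))
        + m * γ * (m * q) * s * (x ^ s * z (x ^ s) ^ (m * q - 1) * v (x ^ s))
        + m * q * s ^ 2 * (x ^ s * z (x ^ s) ^ (m * q - 1) * v (x ^ s)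
          + (m * q - 1) * (x ^ s) ^ 2 * z (x ^ s) ^ (m * q - 1 - 1) * v (x ^ s) ^ 2
          + (x ^ s) ^ 2 * z (x ^ s) ^ (m * q - 1) * w (x ^ s)))) x := by
  have hmem : ∀ x ∈ Ioo 0 ξ0, x ^ s ∈ Ioo 0 t0 := by
    intro x hx
    refine ⟨Real.rpow_pos_of_pos hx.1 s, ?_⟩
    rw [← hξ0]
    exact Real.rpow_lt_rpow hx.1.le hx.2 hs
  intro x hx
  have hx0 : 0 < x := hx.1
  have ht := hmem x hx
  obtain ⟨hzp, hzd, hvd⟩ := hz _ ht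
  have dt : HasDerivAt (fun y : ℝ => y ^ s) (s * x ^ s / x) x := hasDerivAt_rpow_div hx0
  have dz : HasDerivAt (fun y => z (y ^ s)) (v (x ^ s) * (s * x ^ s / x)) x := hzd.comp x dt
  have dv : HasDerivAt (fun y => v (y ^ s)) (w (x ^ s) * (s * x ^ s / x)) x := hvd.comp x dt
  have dze : ∀ e : ℝ, HasDerivAt (fun y => z (y ^ s) ^ e)
      (v (x ^ s) * (s * x ^ s / x) * e * z (x ^ s) ^ (e - 1)) x := fun e =>
    dz.rpow_const (Or.inl hzp.ne')
  have dxe : ∀ e : ℝ, HasDerivAt (fun y : ℝ => y ^ e) (e * x ^ e / x) x := fun e =>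
    hasDerivAt_rpow_div hx0
  have hpos : 0 < prof z s γ q x := mul_pos (Real.rpow_pos_of_pos hx0 _) (Real.rpow_pos_of_pos hzp _)
  refine ⟨ht, hpos, ?_, ?_, ?_⟩
  · refine ((dxe γ).mul (dze q)).congr_deriv ?_
    ring
  · have heq : (fun y => prof z s γ q y ^ m) =ᶠ[𝓝 x] fun y => y ^ (m * γ) * z (y ^ s) ^ (m * q) := by
      filter_upwards [Ioo_mem_nhds hx.1 hx.2] with y hy
      have hzy := (hz _ (hmem y hy)).1
      rw [prof, Real.mul_rpow (Real.rpow_nonneg hy.1.le _) (Real.rpow_nonneg hzy.le _),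
        ← Real.rpow_mul hy.1.le, ← Real.rpow_mul hzy.le, mul_comm γ, mul_comm q]
    refine HasDerivAt.congr_of_eventuallyEq ?_ heq
    refine ((dxe (m * γ)).mul (dze (m * q))).congr_deriv ?_
    rw [profP, Real.rpow_sub_one hx0.ne']
    ring
  · refine ((dxe (m * γ - 1)).mul (((dze (m * q)).const_mul (m * γ)).add
      (((dt.mul (dze (m * q - 1))).mul dv).const_mul (m * q * s)))).congr_deriv ?_
    simp only [Pi.mul_apply, Pi.add_apply]
    ring


set_option maxHeartbeats 2000000 in
theorem exists_typeII_profile_behB3 (m p σ : ℝ) (N : ℕ) (hm : 1 < m) (hp0 : 0 < p) (hp1 : p < 1)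
    (hσ : 2 * (1 - p) / (m - 1) < σ) (hN : 1 ≤ N)
    (hmp : 2 ≤ m + p) :
    ∃ f : ℝ → ℝ, ∃ ξ0 : ℝ, ProfileWithInterface N m p σ f ξ0 ∧ TypeII p f ξ0 ∧
      BehB3 m p σ f := by
  have hm1 : 0 < m - 1 := by linarith
  have h1p : 0 < 1 - p := by linarith
  have hmp' : 0 < m - p := by linarith
  have hσ0 : 0 < σ := lt_trans (by positivity) hσ
  have hL : 0 < σ * (m - 1) + 2 * (p - 1) := by
    rw [div_lt_iff₀ hm1] at hσ
    linarith
  set Lc := σ * (m - 1) + 2 * (p - 1) with hLdef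
  set q := 1 / (1 - p) with hqdef
  set k := (m - 1) / (1 - p) with hkdef
  set γ := (σ + 2) / (m - p) with hγdef
  set s := Lc / (m - p) with hsdef
  have hq : 0 < q := by positivity
  have hk : 1 ≤ k := by rw [hkdef, le_div_iff₀ h1p]; linarith
  have hγ : 0 < γ := by positivity
  have hs : 0 < s := by positivity
  have hβs : betaC m p σ * s = 1 := by
    rw [betaC, hsdef, ← hLdef]; field_simp
  have hα : alphaC m p σ = γ * betaC m p σ := by
    rw [alphaC, betaC, hγdef, ← hLdef]; field_simp
  have hγe : γ * (m - p) = σ + 2 := by rw [hγdef]; field_simp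
  have hγs : γ + s = m * γ - 2 := by
    have : s * (m - p) = Lc := by rw [hsdef]; field_simp
    have h2 : (γ + s - (m * γ - 2)) * (m - p) = 0 := by
      rw [hLdef] at this
      linear_combination this + (1 - m) * hγe
    have := (mul_eq_zero.1 h2).resolve_right hmp'.ne'
    linarith
  have hσγ : σ + γ * p = m * γ - 2 := by linear_combination -hγe
  have hqp : q * (1 - p) = 1 := by rw [hqdef]; field_simp
  have hkq : k = (m - 1) * q := by rw [hkdef, hqdef]; ring
  have hmγ : 2 < m * γ := by linarith
  have hN' : (1 : ℝ) ≤ N := by exact_mod_cast hN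
  have hq1 : 1 < q := by rw [hqdef, lt_div_iff₀ h1p]; linarith
  have hmq : 1 < m * q := by nlinarith
  obtain ⟨z, v, t0, ws, ht0, hws, hz0, hzt0, hzc, hvlim, hcore⟩ :=
    core (q := q) (k := k) (a := s * (m * q) * (2 * (m * γ) + s + N - 2))
      (b := s ^ 2 * (m * q) * (m * q - 1)) (c := s ^ 2 * (m * q))
      (B := m * γ * (m * γ + N - 2)) hq hk
      (mul_nonneg (by positivity) (by linarith)) (mul_nonneg (by positivity) (by linarith))
      (by positivity) (mul_nonneg (by positivity) (by linarith))
  set w : ℝ → ℝ := fun t => -(1 + q * v t + m * γ * (m * γ + N - 2) * z t ^ (k + 1)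
    + s * (m * q) * (2 * (m * γ) + s + N - 2) * t * z t ^ k * v t
    + s ^ 2 * (m * q) * (m * q - 1) * t ^ 2 * z t ^ (k - 1) * v t ^ 2)
      / (s ^ 2 * (m * q) * t ^ 2 * z t ^ k) with hw
  have hcore' : ∀ t ∈ Ioo 0 t0, 0 < z t ∧ HasDerivAt z (v t) t ∧ HasDerivAt v (w t) t := hcore
  set ξ0 := t0 ^ (1 / s) with hξdef
  have hξ0 : 0 < ξ0 := Real.rpow_pos_of_pos ht0 _
  have hξs : ξ0 ^ s = t0 := by
    rw [hξdef, ← Real.rpow_mul ht0.le, one_div_mul_cancel hs.ne', Real.rpow_one]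
  have hD := prof_derivs (γ := γ) (q := q) (m := m) hs hξs hcore'
  set f := prof z s γ q with hf
  have hpowlim : Tendsto (fun x : ℝ => x ^ s) (𝓝[<] ξ0) (𝓝[<] t0) := by
    refine tendsto_nhdsWithin_iff.2 ⟨?_, ?_⟩
    · rw [← hξs]
      exact (Real.continuousAt_rpow_const ξ0 s (Or.inr hs.le)).tendsto.mono_left nhdsWithin_le_nhds
    · filter_upwards [Ioo_mem_nhdsLT hξ0] with x hx
      exact (hD x hx).1.2
  have hzl : Tendsto z (𝓝[<] t0) (𝓝 0) := by
    have := hzc t0 ⟨ht0.le, le_rfl⟩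
    rw [ContinuousWithinAt, hzt0] at this
    refine this.mono_left ?_
    rw [nhdsWithin_le_iff]
    exact mem_of_superset (Ioo_mem_nhdsLT ht0) Ioo_subset_Icc_self
  have hvl' := hvlim.comp hpowlim
  have hzl' := hzl.comp hpowlim
  have hxl : Tendsto (fun x : ℝ => x) (𝓝[<] ξ0) (𝓝 ξ0) := nhdsWithin_le_nhds
  have htl : Tendsto (fun x : ℝ => x ^ s) (𝓝[<] ξ0) (𝓝 t0) := hpowlim.mono_right nhdsWithin_le_nhds
  have hxe : ∀ e : ℝ, Tendsto (fun x : ℝ => x ^ e) (𝓝[<] ξ0) (𝓝 (ξ0 ^ e)) := fun e =>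
    (Real.continuousAt_rpow_const ξ0 e (Or.inl hξ0.ne')).tendsto.comp hxl
  have hze : ∀ e : ℝ, 0 < e → Tendsto (fun x : ℝ => z (x ^ s) ^ e) (𝓝[<] ξ0) (𝓝 0) := fun e he => by
    have := (Real.continuousAt_rpow_const 0 e (Or.inr he.le)).tendsto.comp hzl'
    rwa [Real.zero_rpow he.ne'] at this
  have hzC2 : ContDiffOn ℝ 2 z (Ioo 0 t0) := by
    have hzcont : ContinuousOn z (Ioo 0 t0) := hzc.mono Ioo_subset_Icc_self
    have hvcont : ContinuousOn v (Ioo 0 t0) := fun t ht =>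
      (hcore' t ht).2.2.continuousAt.continuousWithinAt
    have hre : ∀ e : ℝ, ContinuousOn (fun t => z t ^ e) (Ioo 0 t0) := fun e =>
      hzcont.rpow_const (fun t ht => Or.inl (hcore' t ht).1.ne')
    have hwcont : ContinuousOn w (Ioo 0 t0) := by
      have r1 := hre (k + 1)
      have r2 := hre k
      have r3 := hre (k - 1)
      refine ContinuousOn.div (by fun_prop) (by fun_prop) ?_
      intro t ht
      have h1 := Real.rpow_pos_of_pos (hcore' t ht).1 k
      have h2 := ht.1
      positivity
    have hv1 : ContDiffOn ℝ 1 v (Ioo 0 t0) := by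
      rw [show (1 : WithTop ℕ∞) = 0 + 1 by norm_num, contDiffOn_succ_iff_deriv_of_isOpen isOpen_Ioo]
      refine ⟨fun t ht => (hcore' t ht).2.2.differentiableAt.differentiableWithinAt, by simp, ?_⟩
      rw [contDiffOn_zero]
      exact hwcont.congr (fun t ht => (hcore' t ht).2.2.deriv)
    rw [show (2 : WithTop ℕ∞) = 1 + 1 by norm_num, contDiffOn_succ_iff_deriv_of_isOpen isOpen_Ioo]
    refine ⟨fun t ht => (hcore' t ht).2.1.differentiableAt.differentiableWithinAt, by simp, ?_⟩
    exact hv1.congr (fun t ht => (hcore' t ht).2.1.deriv)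
  refine ⟨f, ξ0, ⟨hξ0, ?_, fun x hx => (hD x hx).2.1, ?_, ?_, ?_, ?_⟩, ?_, ?_, z 0 ^ q, by positivity, ?_⟩
  · -- continuity
    refine ContinuousOn.mul ?_ ?_
    · exact (Real.continuous_rpow_const hγ.le).continuousOn
    · refine ContinuousOn.rpow_const ?_ (fun _ _ => Or.inr hq.le)
      refine hzc.comp (Real.continuous_rpow_const hs.le).continuousOn ?_
      intro x hx
      refine ⟨Real.rpow_nonneg hx.1 _, ?_⟩
      rw [← hξs]
      exact Real.rpow_le_rpow hx.1 hx.2 hs.le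
  · -- regularity
    have hid : ∀ e : ℝ, ContDiffOn ℝ 2 (fun x : ℝ => x ^ e) (Ioo 0 ξ0) := fun e =>
      contDiffOn_id.rpow_const_of_ne (fun x hx => hx.1.ne')
    refine (hid γ).mul ?_
    refine ContDiffOn.rpow_const_of_ne ?_ (fun x hx => (hcore' _ (hD x hx).1).1.ne')
    exact hzC2.comp (hid s) (fun x hx => (hD x hx).1)
  · -- the equation
    intro x hx
    obtain ⟨ht, hfp, d1, d2, d3⟩ := hD x hx
    have hx0 : 0 < x := hx.1
    have hev : deriv (fun y => f y ^ m) =ᶠ[𝓝 x] profP z v s γ q m := by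
      filter_upwards [Ioo_mem_nhds hx.1 hx.2] with y hy
      exact (hD y hy).2.2.2.1.deriv
    rw [SSODE, hev.deriv_eq, d3.deriv, d2.deriv, d1.deriv, hα]
    have hzp := (hcore' _ ht).1
    have htp := ht.1
    rw [hf, prof, profP]
    have hWdef : s ^ 2 * (m * q) * (x ^ s) ^ 2 * z (x ^ s) ^ k * w (x ^ s) =
      -(1 + q * v (x ^ s) + m * γ * (m * γ + N - 2) * z (x ^ s) ^ (k + 1)
      + s * (m * q) * (2 * (m * γ) + s + N - 2) * (x ^ s) * z (x ^ s) ^ k * v (x ^ s)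
      + s ^ 2 * (m * q) * (m * q - 1) * (x ^ s) ^ 2 * z (x ^ s) ^ (k - 1) * v (x ^ s) ^ 2) := by
      rw [hw]
      have := Real.rpow_pos_of_pos hzp k
      refine mul_div_cancel₀ _ ?_
      positivity
    have x1 : x ^ (m * γ - 1) = x ^ (m * γ - 2) * x := by
      rw [← Real.rpow_add_one hx0.ne']; congr 1; ring
    have x2 : x ^ γ * x ^ s = x ^ (m * γ - 2) := by
      rw [← Real.rpow_add hx0, hγs]
    have x3 : x ^ σ * (x ^ γ * z (x ^ s) ^ q) ^ p = x ^ (m * γ - 2) * z (x ^ s) ^ (p * q) := by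
      rw [Real.mul_rpow (by positivity) (by positivity), ← Real.rpow_mul hx0.le,
        ← Real.rpow_mul hzp.le, ← mul_assoc, ← Real.rpow_add hx0, hσγ, mul_comm q p]
    rw [x3, x1]
    generalize x ^ (m * γ - 2) = X at *
    generalize x ^ γ = g at *
    generalize x ^ s = t at *
    have z1 : z t ^ q = z t ^ (p * q) * z t := by
      rw [← Real.rpow_add_one hzp.ne']; congr 1; linear_combination hqp
    have z2 : z t ^ (q - 1) = z t ^ (p * q) := by
      congr 1; linear_combination hqp
    have z3 : z t ^ (m * q) = z t ^ (p * q) * z t ^ (k + 1) := by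
      rw [← Real.rpow_add hzp]; congr 1; rw [hkq]; linear_combination hqp
    have z4 : z t ^ (m * q - 1) = z t ^ (p * q) * z t ^ k := by
      rw [← Real.rpow_add hzp]; congr 1; rw [hkq]; linear_combination hqp
    have z5 : z t ^ (m * q - 1 - 1) = z t ^ (p * q) * z t ^ (k - 1) := by
      rw [← Real.rpow_add hzp]; congr 1; rw [hkq]; linear_combination hqp
    rw [z1, z2, z3, z4, z5]
    generalize z t ^ (p * q) = R at *
    generalize z t ^ (k + 1) = K1 at *
    generalize z t ^ (k - 1) = K3 at *
    generalize z t ^ k = K2 at *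
    generalize z t = Z at *
    generalize v t = V at *
    generalize w t = W at *
    generalize betaC m p σ = β at *
    have e1 : X * x / x = X := by field_simp
    have e2 : ((N : ℝ) - 1) / x * (X * x * (m * γ * (R * K1) + m * q * s * (t * (R * K2) * V)))
      = ((N : ℝ) - 1) * X * (m * γ * (R * K1) + m * q * s * (t * (R * K2) * V)) := by field_simp
    have e3 : β * x * (g / x * (γ * (R * Z) + q * s * (t * R * V)))
      = β * g * (γ * (R * Z) + q * s * (t * R * V)) := by field_simp
    rw [e1, e2, e3]
    linear_combination X * R * hWdef + β * q * s * R * V * x2 + X * q * R * V * hβs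
  · -- vanishing
    rw [hf, prof, hξs, hzt0, Real.zero_rpow hq.ne', mul_zero]
  · -- flux
    have hlim : Tendsto (profP z v s γ q m) (𝓝[<] ξ0) (𝓝 (ξ0 ^ (m * γ - 1) * (m * γ * 0
        + m * q * s * (t0 * 0 * ws)))) := by
      refine (hxe _).mul (((hze _ (by linarith)).const_mul _).add
        (((htl.mul (hze _ (by linarith))).mul hvl').const_mul _))
    simp only [mul_zero, zero_mul, add_zero] at hlim
    refine hlim.congr' ?_
    filter_upwards [Ioo_mem_nhdsLT hξ0] with y hy
    exact (hD y hy).2.2.2.1.deriv.symm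
  · -- type II
    let y : ℝ → ℝ := fun x => z (x ^ s)
    have hyd : ∀ x ∈ Ioo 0 ξ0, HasDerivAt y (v (x ^ s) * (s * x ^ s / x)) x := fun x hx =>
      (hcore' _ (hD x hx).1).2.1.comp x (hasDerivAt_rpow_div hx.1)
    have hyξ : y ξ0 = 0 := by simp only [y]; rw [hξs, hzt0]
    have hder : HasDerivWithinAt y (ws * (s * t0 / ξ0)) (Iic ξ0) ξ0 := by
      refine hasDerivWithinAt_Iic_of_tendsto_deriv (s := Ioo 0 ξ0)
        (fun x hx => (hyd x hx).differentiableAt.differentiableWithinAt) ?_ (Ioo_mem_nhdsLT hξ0) ?_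
      · rw [ContinuousWithinAt, hyξ]
        exact hzl'.mono_left (nhdsWithin_mono _ Ioo_subset_Iio_self)
      · have : Tendsto (fun x => v (x ^ s) * (s * x ^ s / x)) (𝓝[<] ξ0) (𝓝 (ws * (s * t0 / ξ0))) :=
          hvl'.mul ((htl.const_mul s).div hxl hξ0.ne')
        refine this.congr' ?_
        filter_upwards [Ioo_mem_nhdsLT hξ0] with x hx
        exact (hyd x hx).deriv.symm
    have hslope := hasDerivWithinAt_iff_tendsto_slope.1 hder
    rw [Iic_sdiff_right] at hslope
    set d := -(ws * (s * t0 / ξ0)) with hd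
    have hdpos : 0 < d := by
      have : 0 < s * t0 / ξ0 := by positivity
      rw [hd]; nlinarith
    refine ⟨ξ0 ^ γ * d ^ q, by positivity, ?_⟩
    have hlim : Tendsto (fun x => x ^ γ * (-(slope y ξ0 x)) ^ q) (𝓝[<] ξ0) (𝓝 (ξ0 ^ γ * d ^ q)) :=
      (hxe γ).mul ((Real.continuousAt_rpow_const d q (Or.inr hq.le)).tendsto.comp hslope.neg)
    refine hlim.congr' ?_
    filter_upwards [Ioo_mem_nhdsLT hξ0] with x hx
    have hpos : 0 < ξ0 - x := sub_pos.2 hx.2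
    have hzp := (hcore' _ (hD x hx).1).1
    have e : -(slope y ξ0 x) = z (x ^ s) * (ξ0 - x)⁻¹ := by
      rw [slope_def_field, hyξ, sub_zero, ← neg_sub ξ0 x, div_neg, neg_neg, div_eq_mul_inv]
    rw [e, Real.mul_rpow hzp.le (by positivity), hf, prof, ← hqdef, Real.rpow_neg hpos.le,
      Real.inv_rpow hpos.le, mul_assoc]
  · rw [hf, prof, Real.zero_rpow hγ.ne', zero_mul]
  · have hlim0 : Tendsto (fun x : ℝ => z (x ^ s)) (𝓝[>] 0) (𝓝 (z 0)) := by
      have h1 := hzc 0 ⟨le_rfl, ht0.le⟩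
      refine h1.tendsto.comp (tendsto_nhdsWithin_iff.2 ⟨?_, ?_⟩)
      · have := (Real.continuousAt_rpow_const 0 s (Or.inr hs.le)).tendsto
        rw [Real.zero_rpow hs.ne'] at this
        exact this.mono_left nhdsWithin_le_nhds
      · filter_upwards [Ioo_mem_nhdsGT hξ0] with x hx
        exact Ioo_subset_Icc_self (hD x hx).1
    have hlim : Tendsto (fun x : ℝ => z (x ^ s) ^ q) (𝓝[>] 0) (𝓝 (z 0 ^ q)) :=
      (Real.continuousAt_rpow_const (z 0) q (Or.inr hq.le)).tendsto.comp hlim0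
    refine hlim.congr' ?_
    filter_upwards [self_mem_nhdsWithin] with x hx
    have hx0 : (0 : ℝ) < x := hx
    have hxγ := Real.rpow_pos_of_pos hx0 γ
    rw [hf, prof, Real.rpow_neg hx0.le, ← hγdef]
    field_simp
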